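/- For all integers m, n ≥ 2, the number of maximal independent sets of the grid graph G_{m×n} is even. -/

import Mathlib

open SimpleGraph Finset

/-- A maximal independent set of a simple graph, as a `Finset` of vertices. -/
def IsMaxIndep {V : Type*} (G : SimpleGraph V) (s : Finset V) : Prop :=
  (∀ ⦃u⦄, u ∈ s → ∀ ⦃v⦄, v ∈ s → ¬ G.Adj u v) ∧
  ∀ t : Finset V, (∀ ⦃u⦄, u ∈ t → ∀ ⦃v⦄, v ∈ t → ¬ G.Adj u v) → s ⊆ t → s = t

/-- The finite set of all maximal independent sets of `G`. -/
noncomputable def misFinset {V : Type*} [Fintype V] (G : SimpleGraph V) : Finset (Finset V) := by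
  classical exact Finset.univ.filter (IsMaxIndep G)

/-- The number of orbits of maximal independent sets of `G` under the action of the
automorphism group of `G`. -/
noncomputable def nimisCard {V : Type*} [Fintype V] [DecidableEq V] (G : SimpleGraph V) : ℕ :=
  Nat.card (Quot (fun M N : {s : Finset V // IsMaxIndep G s} =>
    ∃ e : G ≃g G, (M : Finset V).image e = (N : Finset V)))

/-- The grid graph `G_{m×n}`, the box product of two path graphs. -/
def gridGraph (m n : ℕ) : SimpleGraph (Fin m × Fin n) := pathGraph m □ pathGraph n

theorem isMaxIndep_iff {V : Type*} (G : SimpleGraph V) (s : Finset V) :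
    IsMaxIndep G s ↔ ∀ v, v ∈ s ↔ ∀ u, G.Adj u v → u ∉ s := by
  classical
  constructor
  · rintro ⟨hs, hmax⟩ v
    refine ⟨fun hv u huv hu => hs hu hv huv, fun h => ?_⟩
    have key := hmax (insert v s) ?_ (Finset.subset_insert v s)
    · rw [key]
      exact Finset.mem_insert_self v s
    · intro a ha b hb hab
      rw [Finset.mem_insert] at ha hb
      rcases ha with rfl | ha <;> rcases hb with rfl | hb
      · exact G.loopless.irrefl _ hab
      · exact h b hab.symm hb
      · exact h a hab ha
      · exact hs ha hb hab
  · intro h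
    refine ⟨fun u hu v hv huv => (h v).1 hv u huv hu, fun t ht hst => ?_⟩
    refine hst.antisymm fun v hv => (h v).2 fun u huv hu => ht (hst hu) hv huv

theorem mem_misFinset {V : Type*} [Fintype V] (G : SimpleGraph V) (s : Finset V) :
    s ∈ misFinset G ↔ ∀ v, v ∈ s ↔ ∀ u, G.Adj u v → u ∉ s := by
  rw [← isMaxIndep_iff]
  simp [misFinset]

/-- Pulling back along a locally surjective homomorphism preserves and reflects
maximal independent sets. -/
theorem preimage_mem_misFinset_iff {V W : Type*} [Fintype V] [Fintype W] [DecidableEq W]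
    {G : SimpleGraph V} {H : SimpleGraph W} {f : V → W} (hsurj : Function.Surjective f)
    (hom : ∀ u v, G.Adj u v → H.Adj (f u) (f v))
    (lift : ∀ w v, H.Adj w (f v) → ∃ u, f u = w ∧ G.Adj u v) (t : Finset W) :
    Finset.univ.filter (fun v => f v ∈ t) ∈ misFinset G ↔ t ∈ misFinset H := by
  have nbr : ∀ v, (∀ u, G.Adj u v → f u ∉ t) ↔ ∀ w, H.Adj w (f v) → w ∉ t := fun v =>
    ⟨fun h w hw => by
      obtain ⟨u, rfl, hu⟩ := lift w v hw
      exact h u hu, fun h u hu => h _ (hom u v hu)⟩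
  simp only [mem_misFinset, Finset.mem_filter, Finset.mem_univ, true_and, nbr]
  exact (hsurj.forall (p := fun w => w ∈ t ↔ ∀ u, H.Adj u w → u ∉ t)).symm

/-- The parity of the number of maximal independent sets is determined by those that are
invariant under an involution of the graph. -/
theorem even_card_misFinset_iff_of_involutive {V : Type*} [Fintype V] [DecidableEq V]
    {G : SimpleGraph V} {e : V → V} (he : Function.Involutive e)
    (hom : ∀ u v, G.Adj u v → G.Adj (e u) (e v)) :
    Even (misFinset G).card ↔
      Even ((misFinset G).filter (fun s => ∀ v, e v ∈ s ↔ v ∈ s)).card := by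
  have hsum : ∑ _s ∈ (misFinset G).filter (fun s => ¬ ∀ v, e v ∈ s ↔ v ∈ s), (1 : ZMod 2) = 0 := by
    refine Finset.sum_involution (fun s _ => Finset.univ.filter (fun v => e v ∈ s))
      (fun _ _ => by decide) (fun s hs _ h => ?_) (fun s hs => ?_) (fun s hs => ?_)
    · refine (Finset.mem_filter.1 hs).2 fun v => ?_
      conv_rhs => rw [← h]
      simp
    · rw [Finset.mem_filter] at hs ⊢
      refine ⟨(preimage_mem_misFinset_iff he.surjective hom (fun w v h => ?_) s).2 hs.1,
        fun h => hs.2 fun v => ?_⟩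
      · exact ⟨e w, he w, by simpa [he v] using hom _ _ h⟩
      · simpa [he v] using (h v).symm
    · ext v
      simp [he v]
  rw [Finset.sum_const, nsmul_one, ZMod.natCast_eq_zero_iff_even] at hsum
  rw [← Finset.card_filter_add_card_filter_not (s := misFinset G)
    (fun s => ∀ v, e v ∈ s ↔ v ∈ s), Nat.even_add]
  tauto

theorem gridGraph_adj {m n : ℕ} (u v : Fin m × Fin n) :
    (gridGraph m n).Adj u v ↔
      (u.1.val + 1 = v.1.val ∨ v.1.val + 1 = u.1.val) ∧ u.2.val = v.2.val ∨
      (u.2.val + 1 = v.2.val ∨ v.2.val + 1 = u.2.val) ∧ u.1.val = v.1.val := by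
  simp [gridGraph, boxProd_adj, pathGraph_adj, Fin.ext_iff]

theorem even_card_misFinset_gridGraph_iff_symmetric (m n : ℕ) :
    Even (misFinset (gridGraph m n)).card ↔
      Even ((misFinset (gridGraph m n)).filter
        (fun s => ∀ v, Prod.map Fin.rev id v ∈ s ↔ v ∈ s)).card := by
  refine even_card_misFinset_iff_of_involutive (fun v => by simp [Prod.map]) fun u v h => ?_
  rw [gridGraph_adj] at h ⊢
  simp only [Prod.map_fst, Prod.map_snd, Fin.val_rev, id]
  lia

theorem even_card_misFinset_gridGraph_of_even (k n : ℕ) (hn : 2 ≤ n) (hk : 1 ≤ k) :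
    Even (misFinset (gridGraph (2 * k) n)).card := by
  rw [even_card_misFinset_gridGraph_iff_symmetric]
  suffices h : (misFinset (gridGraph (2 * k) n)).filter
      (fun s => ∀ v, Prod.map Fin.rev id v ∈ s ↔ v ∈ s) = ∅ by
    rw [h]
    simp
  refine Finset.filter_eq_empty_iff.2 fun s hs hsym => ?_
  rw [mem_misFinset] at hs
  have lower : ∀ j, ((⟨k - 1, by lia⟩, j) : Fin (2 * k) × Fin n) ∉ s := fun j hj => by
    refine (hs _).1 hj _ ?_ ((hsym _).2 hj)
    simp only [gridGraph_adj, Prod.map_fst, Prod.map_snd, Fin.val_rev, id]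
    lia
  have upper : ∀ j, ((⟨k, by lia⟩, j) : Fin (2 * k) × Fin n) ∉ s := fun j hj => by
    refine lower j ?_
    convert (hsym _).2 hj using 1
    simp only [Prod.map, id, Prod.mk.injEq, Fin.ext_iff, Fin.val_rev, and_true]
    lia
  have next : ∀ j, ∃ u ∈ s, u.1.val + 2 = k ∧ u.2 = j := fun j => by
    have h := lower j
    rw [hs] at h
    push Not at h
    obtain ⟨⟨a, b⟩, hadj, hu⟩ := h
    refine ⟨(a, b), hu, ?_⟩
    rw [gridGraph_adj] at hadj
    simp only [Fin.ext_iff] at hadj ⊢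
    have h₁ : a.val ≠ k - 1 := fun ha => lower b (by convert hu using 2; exact Fin.ext ha.symm)
    have h₂ : a.val ≠ k := fun ha => upper b (by convert hu using 2; exact Fin.ext ha.symm)
    lia
  obtain ⟨u, hu, hu₁, hu₂⟩ := next ⟨0, by lia⟩
  obtain ⟨v, hv, hv₁, hv₂⟩ := next ⟨1, by lia⟩
  refine (hs v).1 hv u ?_ hu
  rw [gridGraph_adj, hu₂, hv₂]
  simp only
  lia

/-- Folding a path with `2 * k + 1` vertices at its middle vertex. -/
def foldFin (k : ℕ) (i : Fin (2 * k + 1)) : Fin (k + 1) :=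
  ⟨min i.val (2 * k - i.val), by lia⟩

theorem even_card_misFinset_gridGraph_fold (k n : ℕ) :
    Even (misFinset (gridGraph (2 * k + 1) n)).card ↔
      Even (misFinset (gridGraph (k + 1) n)).card := by
  rw [even_card_misFinset_gridGraph_iff_symmetric]
  let f : Fin (2 * k + 1) × Fin n → Fin (k + 1) × Fin n := Prod.map (foldFin k) id
  let g : Fin (k + 1) × Fin n → Fin (2 * k + 1) × Fin n := Prod.map (Fin.castLE (by lia)) id
  have fg : ∀ w, f (g w) = w := fun w => by
    ext <;> simp [f, g, foldFin]
    lia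
  have gf : ∀ v, g (f v) = v ∨ g (f v) = Prod.map Fin.rev id v := fun v => by
    simp [f, g, foldFin, Prod.ext_iff, Fin.ext_iff]
    lia
  have frev : ∀ v, f (Prod.map Fin.rev id v) = f v := fun v => by
    simp [f, foldFin, Prod.ext_iff, Fin.ext_iff]
    lia
  have main : ∀ t, Finset.univ.filter (fun v => f v ∈ t) ∈ misFinset (gridGraph (2 * k + 1) n) ↔
      t ∈ misFinset (gridGraph (k + 1) n) := by
    refine preimage_mem_misFinset_iff (fun w => ⟨g w, fg w⟩) (fun u v h => ?_) fun w v h => ?_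
    · rw [gridGraph_adj] at h ⊢
      simp only [f, foldFin, Prod.map_fst, Prod.map_snd, id]
      lia
    · have hadj := h
      rw [gridGraph_adj] at hadj
      simp only [f, foldFin, Prod.map_fst, Prod.map_snd, id] at hadj
      by_cases hv : v.1.val ≤ k
      · refine ⟨g w, fg w, ?_⟩
        simp only [gridGraph_adj, g, Prod.map_fst, Prod.map_snd, id, Fin.val_castLE]
        lia
      · refine ⟨Prod.map Fin.rev id (g w), by rw [frev, fg], ?_⟩
        simp only [gridGraph_adj, g, Prod.map_fst, Prod.map_snd, id, Fin.val_castLE, Fin.val_rev]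
        lia
  have unfold_fold : ∀ s : Finset (Fin (2 * k + 1) × Fin n),
      (∀ v, Prod.map Fin.rev id v ∈ s ↔ v ∈ s) →
      Finset.univ.filter (fun v => f v ∈ Finset.univ.filter (fun w => g w ∈ s)) = s :=
    fun s hs => by
      ext v
      simp only [Finset.mem_filter, Finset.mem_univ, true_and]
      rcases gf v with h | h <;> rw [h]
      exact hs v
  rw [Finset.card_bij' (t := misFinset (gridGraph (k + 1) n))
    (fun s _ => Finset.univ.filter (fun w => g w ∈ s))
    (fun t _ => Finset.univ.filter (fun v => f v ∈ t))]
  · intro s hs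
    rw [Finset.mem_filter] at hs
    rw [← main, unfold_fold s hs.2]
    exact hs.1
  · intro t ht
    rw [Finset.mem_filter, main]
    exact ⟨ht, fun v => by simp [frev]⟩
  · intro s hs
    exact unfold_fold s (Finset.mem_filter.1 hs).2
  · intro t _
    ext w
    simp [fg]

theorem mis_grid_even (m n : ℕ) (hm : 2 ≤ m) (hn : 2 ≤ n) :
    Even (misFinset (gridGraph m n)).card := by
  induction m using Nat.strong_induction_on with
  | _ m ih =>
    obtain ⟨k, rfl | rfl⟩ := Nat.even_or_odd' m
    · exact even_card_misFinset_gridGraph_of_even k n hn (by lia)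
    · rw [even_card_misFinset_gridGraph_fold]
      exact ih (k + 1) (by lia) (by lia)
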